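/- Let p > 2. The length function L₁ is positive and differentiable on (0, (p/2)^(1/(p−2))) \ {1}, strictly decreasing on (0,1) and strictly increasing on (1, (p/2)^(1/(p−2))); moreover L₁(z) → +∞ as z → 0⁺, L₁(z) → +∞ as z → ((p/2)^(1/(p−2)))⁻, and L₁(z) → π/√(p−2) as z → 1 (from either side). -/

import Mathlib

open MeasureTheory

/-- `f(t) = t²/2 - tᵖ/p`. -/
noncomputable def f (p t : ℝ) : ℝ := t ^ 2 / 2 - t ^ p / p

open Set Filter Topology

lemma quad_pos {q w : ℝ} (hq : 1 < q) (hw : 0 < w) :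
    0 < (4 * q ^ 2 + 2 * q) * w ^ 2 + (2 * q ^ 2 - 14 * q) * w + 6 := by
  rcases le_or_gt 7 q with h | h
  · have : 0 ≤ 2 * q ^ 2 - 14 * q := by nlinarith
    positivity
  · have ha : 0 < 4 * q ^ 2 + 2 * q := by positivity
    have key : 4 * (4 * q ^ 2 + 2 * q) *
        ((4 * q ^ 2 + 2 * q) * w ^ 2 + (2 * q ^ 2 - 14 * q) * w + 6) =
        (2 * (4 * q ^ 2 + 2 * q) * w + (2 * q ^ 2 - 14 * q)) ^ 2
          + 4 * q * (q - 1) ^ 2 * (12 - q) := by ring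
    have h1 : 0 < 4 * q * (q - 1) ^ 2 * (12 - q) := by
      have : 0 < q - 1 := by linarith
      have : 0 < 12 - q := by linarith
      positivity
    have h2 : 0 < 4 * (4 * q ^ 2 + 2 * q) *
        ((4 * q ^ 2 + 2 * q) * w ^ 2 + (2 * q ^ 2 - 14 * q) * w + 6) := by
      rw [key]; positivity
    exact (mul_pos_iff_of_pos_left (by positivity)).1 h2

lemma hasDerivAt_rpow_sub_two (p : ℝ) {x : ℝ} (hx : 0 < x) :
    HasDerivAt (fun x : ℝ => x ^ (p - 2)) ((p - 2) * x ^ (p - 2) / x) x := by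
  convert Real.hasDerivAt_rpow_const (p := p - 2) (Or.inl hx.ne') using 1
  rw [Real.rpow_sub_one hx.ne']; ring

lemma rpow_eq_sq_mul (p : ℝ) {x : ℝ} (hx : 0 < x) : x ^ p = x ^ 2 * x ^ (p - 2) := by
  rw [Real.rpow_sub hx, Real.rpow_two]; field_simp

/-- The potential `V = f(1) - f`, whose only zero on the positive half-line is its minimum `1`. -/
noncomputable def pot (p x : ℝ) : ℝ := f p 1 - f p x

lemma pot_one (p : ℝ) : pot p 1 = 0 := by simp [pot]

lemma hasDerivAt_pot {p : ℝ} (hp : 2 < p) {x : ℝ} (hx : 0 < x) :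
    HasDerivAt (pot p) (x * (x ^ (p - 2) - 1)) x := by
  have h1 := (Real.hasDerivAt_rpow_const (p := p) (Or.inl hx.ne')).div_const p
  have h2 := (((hasDerivAt_id x).pow 2).div_const 2).sub h1
  have h3 := h2.const_sub (f p 1)
  refine h3.congr_deriv ?_
  have : x ^ (p - 1) = x * x ^ (p - 2) := by
    rw [Real.rpow_sub_one hx.ne', rpow_eq_sq_mul p hx]; field_simp
  rw [this]
  simp
  field_simp

lemma hasDerivAt_pot_deriv (p : ℝ) {x : ℝ} (hx : 0 < x) :
    HasDerivAt (fun x : ℝ => x * (x ^ (p - 2) - 1)) ((p - 1) * x ^ (p - 2) - 1) x := by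
  refine ((hasDerivAt_id x).mul ((hasDerivAt_rpow_sub_two p hx).sub_const 1)).congr_deriv ?_
  simp
  field_simp
  ring

lemma rpow_sub_two_lt_one {p : ℝ} (hp : 2 < p) {x : ℝ} (hx : 0 < x) (h : x < 1) :
    x ^ (p - 2) < 1 := Real.rpow_lt_one hx.le h (by linarith)

lemma one_lt_rpow_sub_two {p : ℝ} (hp : 2 < p) {x : ℝ} (h : 1 < x) :
    1 < x ^ (p - 2) := Real.one_lt_rpow h (by linarith)

lemma rpow_sub_two_ne_one {p : ℝ} (hp : 2 < p) {x : ℝ} (hx : 0 < x) (h : x ≠ 1) :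
    x ^ (p - 2) ≠ 1 := by
  rcases lt_or_gt_of_ne h with h | h
  · exact (rpow_sub_two_lt_one hp hx h).ne
  · exact (one_lt_rpow_sub_two hp h).ne'

/-- A function that vanishes at `1` and whose derivative has the sign of
`x - 1` between `x` and `1` is positive at `x`. -/
lemma pos_of_deriv_sign {D D' : ℝ → ℝ} {x : ℝ} (hx1 : x ≠ 1) (h1 : D 1 = 0)
    (hD : ∀ y ∈ uIcc x 1, HasDerivAt D (D' y) y)
    (hneg : x < 1 → ∀ y ∈ Ioo x 1, D' y < 0) (hpos : 1 < x → ∀ y ∈ Ioo 1 x, 0 < D' y) :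
    0 < D x := by
  rcases lt_or_gt_of_ne hx1 with h | h
  · rw [uIcc_of_le h.le] at hD
    have := strictAntiOn_of_deriv_neg (convex_Icc x 1)
      (fun y hy => (hD y hy).continuousAt.continuousWithinAt) (fun y hy => by
        rw [interior_Icc] at hy
        rw [(hD y (Ioo_subset_Icc_self hy)).deriv]
        exact hneg h y hy)
    rw [← h1]
    exact this (left_mem_Icc.2 h.le) (right_mem_Icc.2 h.le) h
  · rw [uIcc_of_ge h.le] at hD
    have := strictMonoOn_of_deriv_pos (convex_Icc 1 x)
      (fun y hy => (hD y hy).continuousAt.continuousWithinAt) (fun y hy => by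
        rw [interior_Icc] at hy
        rw [(hD y (Ioo_subset_Icc_self hy)).deriv]
        exact hpos h y hy)
    rw [← h1]
    exact this (left_mem_Icc.2 h.le) (right_mem_Icc.2 h.le) h

lemma pot_pos {p : ℝ} (hp : 2 < p) {x : ℝ} (hx : 0 < x) (hx1 : x ≠ 1) : 0 < pot p x := by
  refine pos_of_deriv_sign hx1 (pot_one p) (fun y hy => hasDerivAt_pot hp ?_) ?_ ?_
  · exact lt_of_lt_of_le (lt_min hx one_pos) hy.1
  · intro _ y hy
    have hy0 : 0 < y := hx.trans hy.1
    have := rpow_sub_two_lt_one hp hy0 hy.2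
    exact mul_neg_of_pos_of_neg hy0 (by linarith)
  · intro _ y hy
    have := one_lt_rpow_sub_two hp hy.1
    exact mul_pos (one_pos.trans hy.1) (by linarith)

/-- The key inequality behind the convexity of the potential divided by its squared derivative. -/
lemma mul_quad_lt_pot_mul {p : ℝ} (hp : 2 < p) {x : ℝ} (hx : 0 < x) (hx1 : x ≠ 1) :
    3 * x ^ 2 * (x ^ (p - 2) - 1) ^ 2 * ((p - 1) * x ^ (p - 2) - 1) <
      pot p x * ((4 * (p - 1) ^ 2 + 2 * (p - 1)) * (x ^ (p - 2)) ^ 2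
        + (2 * (p - 1) ^ 2 - 14 * (p - 1)) * x ^ (p - 2) + 6) := by
  have hq : 1 < p - 1 := by linarith
  have hA : ∀ y : ℝ, 0 < y → 0 < (4 * (p - 1) ^ 2 + 2 * (p - 1)) * (y ^ (p - 2)) ^ 2
        + (2 * (p - 1) ^ 2 - 14 * (p - 1)) * y ^ (p - 2) + 6 :=
    fun y hy => quad_pos hq (Real.rpow_pos_of_pos hy _)
  have hV := pot_pos hp hx hx1
  rcases le_or_gt ((p - 1) * x ^ (p - 2)) 1 with hB | hB
  · refine lt_of_le_of_lt ?_ (mul_pos hV (hA x hx))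
    exact mul_nonpos_of_nonneg_of_nonpos (by positivity) (by linarith)
  have hQ : ∀ y : ℝ, 0 < y → 1 < (p - 1) * y ^ (p - 2) →
      0 < (p - 1) * (p - 2) * y ^ (p - 2) *
        ((4 * (p - 1) + 2) * ((p - 1) * y ^ (p - 2)) + 6 * (p - 3)) := by
    intro y hy h
    have h1 : 0 < (p - 1) * (p - 2) := mul_pos (by linarith) (by linarith)
    have h2 := Real.rpow_pos_of_pos hy (p - 2)
    have h3 : 4 * (p - 1) + 2 < (4 * (p - 1) + 2) * ((p - 1) * y ^ (p - 2)) :=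
      lt_mul_of_one_lt_right (by linarith) h
    have h4 : 0 < (4 * (p - 1) + 2) * ((p - 1) * y ^ (p - 2)) + 6 * (p - 3) := by linarith
    positivity
  let A : ℝ → ℝ := fun y => (4 * (p - 1) ^ 2 + 2 * (p - 1)) * (y ^ (p - 2)) ^ 2
        + (2 * (p - 1) ^ 2 - 14 * (p - 1)) * y ^ (p - 2) + 6
  let Q : ℝ → ℝ := fun y => (p - 1) * (p - 2) * y ^ (p - 2) *
        ((4 * (p - 1) + 2) * ((p - 1) * y ^ (p - 2)) + 6 * (p - 3))
  have hpos : 0 < pot p x -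
      3 * x ^ 2 * (x ^ (p - 2) - 1) ^ 2 * ((p - 1) * x ^ (p - 2) - 1) / A x := by
    refine pos_of_deriv_sign (D := fun y => pot p y -
      3 * y ^ 2 * (y ^ (p - 2) - 1) ^ 2 * ((p - 1) * y ^ (p - 2) - 1) / A y)
      (D' := fun y => y * (y ^ (p - 2) - 1) ^ 3 * Q y / A y ^ 2) hx1 (by simp [pot_one])
      ?_ ?_ ?_
    · intro y hy
      have hy0 : 0 < y := lt_of_lt_of_le (lt_min hx one_pos) hy.1
      have hw := hasDerivAt_rpow_sub_two p hy0
      have hAy : A y ≠ 0 := (hA y hy0).ne'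
      have hAd : HasDerivAt A _ y := (((hw.pow 2).const_mul (4 * (p - 1) ^ 2 + 2 * (p - 1))).add
        (hw.const_mul (2 * (p - 1) ^ 2 - 14 * (p - 1)))).add_const 6
      have hN := ((((hasDerivAt_id y).pow 2).const_mul 3).mul ((hw.sub_const 1).pow 2)).mul
        ((hw.const_mul (p - 1)).sub_const 1)
      refine ((hasDerivAt_pot hp hy0).sub (hN.div hAd hAy)).congr_deriv ?_
      simp only [Pi.mul_apply, Pi.pow_apply, id]
      have hy' := hy0.ne'
      field_simp
      simp only [A, Q]
      generalize y ^ (p - 2) = w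
      push_cast
      ring
    · intro h y hy
      have hy0 : 0 < y := hx.trans hy.1
      have hBy : 1 < (p - 1) * y ^ (p - 2) := by
        refine hB.trans (mul_lt_mul_of_pos_left ?_ (by linarith))
        exact Real.rpow_lt_rpow hx.le hy.1 (by linarith)
      have h1 := rpow_sub_two_lt_one hp hy0 hy.2
      have h2 : (y ^ (p - 2) - 1) ^ 3 < 0 := Odd.pow_neg (by decide) (by linarith)
      exact div_neg_of_neg_of_pos (mul_neg_of_neg_of_pos (mul_neg_of_pos_of_neg hy0 h2)
        (hQ y hy0 hBy)) (pow_pos (hA y hy0) 2)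
    · intro h y hy
      have hy0 : 0 < y := one_pos.trans hy.1
      have h1 := one_lt_rpow_sub_two hp hy.1
      have hBy : 1 < (p - 1) * y ^ (p - 2) := by nlinarith
      exact div_pos (mul_pos (mul_pos hy0 (pow_pos (by linarith) 3)) (hQ y hy0 hBy))
        (pow_pos (hA y hy0) 2)
  have := (div_lt_iff₀ (hA x hx)).1 (sub_pos.1 hpos)
  exact this

/-- The smooth factor `W` in `V(x) = (x - 1)² W(x)`. -/
noncomputable def potFactor (p : ℝ) : ℝ → ℝ := dslope (dslope (pot p) 1) 1

/-- The signed square root of the potential. -/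
noncomputable def potRoot (p x : ℝ) : ℝ := (x - 1) * √(potFactor p x)

lemma analyticAt_dslope {g : ℝ → ℝ} {x y : ℝ} (hx : AnalyticAt ℝ g x) (hy : AnalyticAt ℝ g y) :
    AnalyticAt ℝ (dslope g x) y := by
  rcases eq_or_ne y x with rfl | h
  · obtain ⟨P, hP⟩ := hx
    exact ⟨_, hP.has_fpower_series_dslope_fslope⟩
  · have : dslope g x =ᶠ[𝓝 y] fun z => (g z - g x) / (z - x) := by
      filter_upwards [isOpen_ne.mem_nhds h] with z hz
      rw [dslope_of_ne _ hz, slope_def_field]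
    refine AnalyticAt.congr ?_ this.symm
    exact (hy.sub analyticAt_const).div (analyticAt_id.sub analyticAt_const) (sub_ne_zero.2 h)

lemma analyticAt_pot (p : ℝ) {x : ℝ} (hx : 0 < x) : AnalyticAt ℝ (pot p) x := by
  have h : AnalyticAt ℝ (fun y : ℝ => y ^ p) x :=
    (Real.contDiffAt_rpow_const_of_ne hx.ne').analyticAt
  exact analyticAt_const.sub (((analyticAt_id.pow 2).div_const).sub h.div_const)

lemma analyticAt_potFactor (p : ℝ) {x : ℝ} (hx : 0 < x) : AnalyticAt ℝ (potFactor p) x :=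
  analyticAt_dslope (analyticAt_dslope (analyticAt_pot p one_pos) (analyticAt_pot p one_pos))
    (analyticAt_dslope (analyticAt_pot p one_pos) (analyticAt_pot p hx))

lemma sq_mul_potFactor {p : ℝ} (hp : 2 < p) (x : ℝ) :
    (x - 1) ^ 2 * potFactor p x = pot p x := by
  have h1 := sub_smul_dslope (pot p) 1 x
  have h2 := sub_smul_dslope (dslope (pot p) 1) 1 x
  have h3 : deriv (pot p) 1 = 0 := by rw [(hasDerivAt_pot hp one_pos).deriv]; simp
  rw [dslope_same, h3, sub_zero] at h2
  rw [pot_one, sub_zero] at h1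
  rw [← h1, ← h2, potFactor]
  simp only [smul_eq_mul]; ring

lemma potFactor_one {p : ℝ} (hp : 2 < p) : potFactor p 1 = (p - 2) / 2 := by
  have hW : ∀ x : ℝ, 0 < x → HasDerivAt (potFactor p) (deriv (potFactor p) x) x :=
    fun x hx => (analyticAt_potFactor p hx).differentiableAt.hasDerivAt
  have hev : ∀ᶠ x : ℝ in 𝓝 1, x * (x ^ (p - 2) - 1) =
      2 * (x - 1) * potFactor p x + (x - 1) ^ 2 * deriv (potFactor p) x := by
    filter_upwards [lt_mem_nhds one_pos] with x hx
    have h1 := (((hasDerivAt_id x).sub_const 1).pow 2).mul (hW x hx)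
    have h3 : HasDerivAt (pot p) _ x := h1.congr_of_eventuallyEq
      (Eventually.of_forall fun y => (sq_mul_potFactor hp y).symm)
    rw [(hasDerivAt_pot hp hx).unique h3]
    simp
  have hd := (analyticAt_potFactor p one_pos).deriv.differentiableAt.hasDerivAt
  have h4 := ((((hasDerivAt_id (1 : ℝ)).sub_const 1).const_mul 2).mul (hW 1 one_pos)).add
    ((((hasDerivAt_id (1 : ℝ)).sub_const 1).pow 2).mul hd)
  have h5 := (hasDerivAt_pot_deriv p one_pos).unique (h4.congr_of_eventuallyEq hev)
  simp at h5
  linarith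

lemma potFactor_pos {p : ℝ} (hp : 2 < p) {x : ℝ} (hx : 0 < x) : 0 < potFactor p x := by
  rcases eq_or_ne x 1 with rfl | h
  · rw [potFactor_one hp]; linarith
  · have h1 := pot_pos hp hx h
    rw [← sq_mul_potFactor hp x] at h1
    exact pos_of_mul_pos_right h1 (sq_nonneg _)

lemma potRoot_sq {p : ℝ} (hp : 2 < p) {x : ℝ} (hx : 0 < x) : potRoot p x ^ 2 = pot p x := by
  rw [potRoot, mul_pow, Real.sq_sqrt (potFactor_pos hp hx).le, sq_mul_potFactor hp]

lemma potRoot_one (p : ℝ) : potRoot p 1 = 0 := by simp [potRoot]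

lemma potRoot_ne_zero {p : ℝ} (hp : 2 < p) {x : ℝ} (hx : 0 < x) (h : x ≠ 1) : potRoot p x ≠ 0 :=
  mul_ne_zero (sub_ne_zero.2 h) (Real.sqrt_pos.2 (potFactor_pos hp hx)).ne'

lemma analyticAt_potRoot {p : ℝ} (hp : 2 < p) {x : ℝ} (hx : 0 < x) :
    AnalyticAt ℝ (potRoot p) x :=
  (analyticAt_id.sub analyticAt_const).mul
    ((analyticAt_potFactor p hx).contDiffAt.sqrt (potFactor_pos hp hx).ne').analyticAt

lemma hasDerivAt_potRoot {p : ℝ} (hp : 2 < p) {x : ℝ} (hx : 0 < x) :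
    HasDerivAt (potRoot p) (deriv (potRoot p) x) x :=
  (analyticAt_potRoot hp hx).differentiableAt.hasDerivAt

lemma two_mul_potRoot_mul_deriv {p : ℝ} (hp : 2 < p) {x : ℝ} (hx : 0 < x) :
    2 * potRoot p x * deriv (potRoot p) x = x * (x ^ (p - 2) - 1) := by
  have h1 := (hasDerivAt_potRoot hp hx).pow 2
  have h2 : HasDerivAt (potRoot p ^ 2) (x * (x ^ (p - 2) - 1)) x :=
    (hasDerivAt_pot hp hx).congr_of_eventuallyEq (by
      filter_upwards [lt_mem_nhds hx] with y hy using potRoot_sq hp hy)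
  simpa using h1.unique h2

lemma deriv_potRoot_one {p : ℝ} (hp : 2 < p) : deriv (potRoot p) 1 = √((p - 2) / 2) := by
  have h := ((hasDerivAt_id (1 : ℝ)).sub_const 1).mul
    ((analyticAt_potFactor p one_pos).contDiffAt (n := 1) |>.sqrt
      (potFactor_pos hp one_pos).ne' |>.differentiableAt one_ne_zero).hasDerivAt
  have h' : HasDerivAt (potRoot p) _ 1 := h
  rw [h'.deriv]
  simp [potFactor_one hp]

lemma deriv_potRoot_pos {p : ℝ} (hp : 2 < p) {x : ℝ} (hx : 0 < x) :
    0 < deriv (potRoot p) x := by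
  have h := two_mul_potRoot_mul_deriv hp hx
  have hs := Real.sqrt_pos.2 (potFactor_pos hp hx)
  rcases lt_trichotomy x 1 with h1 | rfl | h1
  · have h2 : potRoot p x < 0 := mul_neg_of_neg_of_pos (by linarith) hs
    have h3 := mul_neg_of_pos_of_neg hx (sub_neg.2 (rpow_sub_two_lt_one hp hx h1))
    rw [← h] at h3
    exact (neg_iff_pos_of_mul_neg h3).1 (by linarith)
  · rw [deriv_potRoot_one hp]
    exact Real.sqrt_pos.2 (by linarith)
  · have h2 : 0 < potRoot p x := mul_pos (by linarith) hs
    have h3 := mul_pos hx (sub_pos.2 (one_lt_rpow_sub_two hp h1))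
    rw [← h] at h3
    exact (pos_iff_pos_of_mul_pos h3).1 (by linarith)

lemma strictMonoOn_potRoot {p : ℝ} (hp : 2 < p) : StrictMonoOn (potRoot p) (Ioi 0) := by
  refine strictMonoOn_of_deriv_pos (convex_Ioi 0)
    (fun x hx => (analyticAt_potRoot hp hx).continuousAt.continuousWithinAt) fun x hx => ?_
  rw [interior_Ioi] at hx
  exact deriv_potRoot_pos hp hx

/-- The slope of the inverse of the signed square root of the potential, as a
function of `x`. -/
noncomputable def invSlope (p x : ℝ) : ℝ := (deriv (potRoot p) x)⁻¹

lemma analyticAt_invSlope {p : ℝ} (hp : 2 < p) {x : ℝ} (hx : 0 < x) :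
    AnalyticAt ℝ (invSlope p) x :=
  (analyticAt_potRoot hp hx).deriv.inv (deriv_potRoot_pos hp hx).ne'

lemma invSlope_pos {p : ℝ} (hp : 2 < p) {x : ℝ} (hx : 0 < x) : 0 < invSlope p x :=
  inv_pos.2 (deriv_potRoot_pos hp hx)

lemma invSlope_sq {p : ℝ} (hp : 2 < p) {x : ℝ} (hx : 0 < x) (h1 : x ≠ 1) :
    invSlope p x ^ 2 = 4 * pot p x / (x * (x ^ (p - 2) - 1)) ^ 2 := by
  have h2 := (deriv_potRoot_pos hp hx).ne'
  have h3 := potRoot_ne_zero hp hx h1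
  rw [← two_mul_potRoot_mul_deriv hp hx, ← potRoot_sq hp hx, invSlope]
  field_simp
  norm_num

/-- The convexity of the potential divided by its squared derivative, expressed through its
derivative. -/
lemma strictMonoOn_invSlope_mul_deriv {p : ℝ} (hp : 2 < p) :
    StrictMonoOn (fun x => deriv (invSlope p) x * invSlope p x) (Ioi 0) := by
  have hcont : ∀ x : ℝ, 0 < x →
      ContinuousAt (fun x => deriv (invSlope p) x * invSlope p x) x := fun x hx =>
    (analyticAt_invSlope hp hx).deriv.continuousAt.mul (analyticAt_invSlope hp hx).continuousAt
  have hformula : ∀ x : ℝ, 0 < x → x ≠ 1 → deriv (invSlope p) x * invSlope p x =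
      2 * ((x * (x ^ (p - 2) - 1)) ^ 2 - 2 * pot p x * ((p - 1) * x ^ (p - 2) - 1)) /
        (x * (x ^ (p - 2) - 1)) ^ 3 := by
    intro x hx hx1
    have hw : x * (x ^ (p - 2) - 1) ≠ 0 :=
      mul_ne_zero hx.ne' (sub_ne_zero.2 (rpow_sub_two_ne_one hp hx hx1))
    have h1 := (analyticAt_invSlope hp hx).differentiableAt.hasDerivAt.pow 2
    have h2 := ((hasDerivAt_pot hp hx).const_mul 4).div ((hasDerivAt_pot_deriv p hx).pow 2)
      (pow_ne_zero 2 hw)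
    have h3 := h1.unique (h2.congr_of_eventuallyEq (by
      filter_upwards [lt_mem_nhds hx, isOpen_ne.mem_nhds hx1] with y hy hy1 using
        invSlope_sq hp hy hy1))
    simp only [Pi.pow_apply] at h3
    have h4 : deriv (invSlope p) x * invSlope p x =
      (((2 : ℕ) : ℝ) * invSlope p x ^ (2 - 1) * deriv (invSlope p) x) / 2 := by
      norm_num; ring
    rw [h4, h3]
    generalize hu : x * (x ^ (p - 2) - 1) = u at *
    field_simp
    push_cast
    ring
  have hderiv : ∀ x : ℝ, 0 < x → x ≠ 1 →
      0 < deriv (fun x => deriv (invSlope p) x * invSlope p x) x := by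
    intro x hx hx1
    have hw1 := rpow_sub_two_ne_one hp hx hx1
    have hw : x * (x ^ (p - 2) - 1) ≠ 0 := mul_ne_zero hx.ne' (sub_ne_zero.2 hw1)
    have hV1 := hasDerivAt_pot_deriv p hx
    have h2 := ((((hV1.pow 2).sub (((hasDerivAt_pot hp hx).const_mul 2).mul
      (((hasDerivAt_rpow_sub_two p hx).const_mul (p - 1)).sub_const 1))).const_mul 2).div
      (hV1.pow 3) (pow_ne_zero 3 hw))
    have h3 := h2.congr_of_eventuallyEq (f₁ := fun x => deriv (invSlope p) x * invSlope p x) (by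
      filter_upwards [lt_mem_nhds hx, isOpen_ne.mem_nhds hx1] with y hy hy1 using
        hformula y hy hy1)
    rw [h3.deriv]
    have key := mul_quad_lt_pot_mul hp hx hx1
    have h4 : 0 < 2 * (pot p x * ((4 * (p - 1) ^ 2 + 2 * (p - 1)) * (x ^ (p - 2)) ^ 2
        + (2 * (p - 1) ^ 2 - 14 * (p - 1)) * x ^ (p - 2) + 6) -
        3 * x ^ 2 * (x ^ (p - 2) - 1) ^ 2 * ((p - 1) * x ^ (p - 2) - 1)) /
        (x * (x ^ (p - 2) - 1)) ^ 4 :=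
      div_pos (by linarith) (by positivity)
    convert h4 using 1
    have hw2 := sub_ne_zero.2 hw1
    simp only [Pi.pow_apply, Pi.mul_apply, Pi.sub_apply]
    generalize pot p x = V at *
    generalize x ^ (p - 2) = w at *
    field_simp
    push_cast
    ring
  have hl : StrictMonoOn (fun x => deriv (invSlope p) x * invSlope p x) (Ioc 0 1) := by
    refine strictMonoOn_of_deriv_pos (convex_Ioc 0 1)
      (fun x hx => (hcont x hx.1).continuousWithinAt) fun x hx => ?_
    rw [interior_Ioc] at hx
    exact hderiv x hx.1 hx.2.ne
  have hr : StrictMonoOn (fun x => deriv (invSlope p) x * invSlope p x) (Ici 1) := by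
    refine strictMonoOn_of_deriv_pos (convex_Ici 1)
      (fun x hx => (hcont x (one_pos.trans_le hx)).continuousWithinAt) fun x hx => ?_
    rw [interior_Ici] at hx
    exact hderiv x (one_pos.trans hx) (ne_of_gt hx)
  have := hl.union hr (c := 1) ⟨⟨one_pos, le_rfl⟩, fun x hx => hx.2⟩ ⟨mem_Ici.2 le_rfl, fun x hx => hx⟩
  rwa [Ioc_union_Ici_eq_Ioi one_pos] at this

lemma mul_sin_mem_Ioo {S k : ℝ} (hk : k ∈ Ioo (-S) S) (θ : ℝ) : k * Real.sin θ ∈ Ioo (-S) S := by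
  rw [mem_Ioo, ← abs_lt] at hk ⊢
  rw [abs_mul]
  exact (mul_le_of_le_one_right (abs_nonneg k) (Real.abs_sin_le_one θ)).trans_lt hk

/-- The mean of `g` over the projection of a circle of radius `k`, up to normalisation. -/
noncomputable def arcMean (g : ℝ → ℝ) (k : ℝ) : ℝ :=
  ∫ θ in (-(Real.pi / 2))..(Real.pi / 2), g (k * Real.sin θ)

lemma arcMean_zero (g : ℝ → ℝ) : arcMean g 0 = Real.pi * g 0 := by
  simp [arcMean]

lemma arcMean_neg (g : ℝ → ℝ) (k : ℝ) : arcMean g (-k) = arcMean g k := by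
  have h := intervalIntegral.integral_comp_neg (a := -(Real.pi / 2)) (b := Real.pi / 2)
    (fun θ => g (k * Real.sin θ))
  simpa [arcMean] using h

lemma arcMean_abs (g : ℝ → ℝ) (k : ℝ) : arcMean g |k| = arcMean g k := by
  rcases abs_choice k with h | h <;> rw [h]
  exact arcMean_neg g k

lemma continuous_comp_mul_sin {g : ℝ → ℝ} {S k : ℝ} (hg : ContinuousOn g (Ioo (-S) S))
    (hk : k ∈ Ioo (-S) S) : Continuous fun θ => g (k * Real.sin θ) :=
  hg.comp_continuous (by fun_prop) (mul_sin_mem_Ioo hk)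

lemma arcMean_pos {g : ℝ → ℝ} {S k : ℝ} (hg : ContinuousOn g (Ioo (-S) S))
    (hpos : ∀ s ∈ Ioo (-S) S, 0 < g s) (hk : k ∈ Ioo (-S) S) : 0 < arcMean g k :=
  intervalIntegral.intervalIntegral_pos_of_pos
    ((continuous_comp_mul_sin hg hk).intervalIntegrable _ _)
    (fun θ => hpos _ (mul_sin_mem_Ioo hk θ)) (by linarith [Real.pi_pos])

lemma strictConvexOn_arcMean {g : ℝ → ℝ} {S : ℝ} (hg : ContinuousOn g (Ioo (-S) S))
    (hconv : StrictConvexOn ℝ (Ioo (-S) S) g) : StrictConvexOn ℝ (Ioo (-S) S) (arcMean g) := by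
  refine ⟨convex_Ioo _ _, fun x hx y hy hxy u v hu hv huv => ?_⟩
  have hxc := continuous_comp_mul_sin hg hx
  have hyc := continuous_comp_mul_sin hg hy
  have hz : u * x + v * y ∈ Ioo (-S) S := convex_Ioo _ _ hx hy hu.le hv.le huv
  have heq : ∀ θ, (u * x + v * y) * Real.sin θ =
      u • (x * Real.sin θ) + v • (y * Real.sin θ) := fun θ => by
    simp only [smul_eq_mul]; ring
  have h : u • arcMean g x + v • arcMean g y = ∫ θ in (-(Real.pi / 2))..(Real.pi / 2),
      (u * g (x * Real.sin θ) + v * g (y * Real.sin θ)) := by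
    rw [intervalIntegral.integral_add ((hxc.const_mul u).intervalIntegrable _ _)
      ((hyc.const_mul v).intervalIntegrable _ _), intervalIntegral.integral_const_mul,
      intervalIntegral.integral_const_mul]
    rfl
  rw [h]
  refine intervalIntegral.integral_lt_integral_of_continuousOn_of_le_of_exists_lt
    (by linarith [Real.pi_pos]) (continuous_comp_mul_sin hg hz).continuousOn
    ((hxc.const_mul u).add (hyc.const_mul v)).continuousOn (fun θ _ => ?_)
    ⟨Real.pi / 2, ⟨by linarith [Real.pi_pos], le_rfl⟩, ?_⟩
  · simp only [smul_eq_mul, heq]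
    exact hconv.convexOn.2 (mul_sin_mem_Ioo hx θ) (mul_sin_mem_Ioo hy θ) hu.le hv.le huv
  · simpa using hconv.2 hx hy hxy hu hv huv

lemma strictMonoOn_arcMean {g : ℝ → ℝ} {S : ℝ} (hg : ContinuousOn g (Ioo (-S) S))
    (hconv : StrictConvexOn ℝ (Ioo (-S) S) g) : StrictMonoOn (arcMean g) (Ico 0 S) := by
  intro x hx y hy hxy
  have hy0 : 0 < y := hx.1.trans_lt hxy
  have hmem : y ∈ Ioo (-S) S := ⟨by linarith [hy.2], hy.2⟩
  have hmem' : -y ∈ Ioo (-S) S := ⟨by linarith [hy.2], by linarith [hy.2]⟩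
  have hu : 0 < (y + x) / (2 * y) := div_pos (by linarith [hx.1]) (by linarith)
  have hv : 0 < (y - x) / (2 * y) := div_pos (by linarith) (by linarith)
  have e2 : (y + x) / (2 * y) + (y - x) / (2 * y) = 1 := by field_simp; ring
  have h := (strictConvexOn_arcMean hg hconv).2 hmem hmem' (by linarith) hu hv e2
  have e1 : ((y + x) / (2 * y)) • y + ((y - x) / (2 * y)) • (-y) = x := by
    simp only [smul_eq_mul]; field_simp; ring
  rwa [e1, arcMean_neg, ← add_smul, e2, one_smul] at h

lemma differentiableAt_arcMean {g g' : ℝ → ℝ} {S k : ℝ}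
    (hg : ∀ s ∈ Ioo (-S) S, HasDerivAt g (g' s) s) (hg' : ContinuousOn g' (Ioo (-S) S))
    (hk : k ∈ Ioo (-S) S) : DifferentiableAt ℝ (arcMean g) k := by
  obtain ⟨r, hkr, hrS⟩ := exists_between (abs_lt.2 hk)
  have hsub : Icc (-r) r ⊆ Ioo (-S) S := fun s hs => ⟨by linarith [hs.1], by linarith [hs.2]⟩
  have hsub' : Ioo (-r) r ⊆ Ioo (-S) S := Ioo_subset_Icc_self.trans hsub
  have hgc : ContinuousOn g (Ioo (-S) S) := fun s hs => (hg s hs).continuousAt.continuousWithinAt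
  obtain ⟨C, hC⟩ := isCompact_Icc.exists_bound_of_continuousOn (hg'.mono hsub)
  have hnhds : Ioo (-r) r ∈ 𝓝 k := Ioo_mem_nhds (abs_lt.1 hkr).1 (abs_lt.1 hkr).2
  refine (intervalIntegral.hasDerivAt_integral_of_dominated_loc_of_deriv_le
    (F := fun k θ => g (k * Real.sin θ)) (F' := fun k θ => g' (k * Real.sin θ) * Real.sin θ)
    (bound := fun _ => C) hnhds ?_ ((continuous_comp_mul_sin hgc hk).intervalIntegrable _ _)
    ((continuous_comp_mul_sin hg' hk).mul Real.continuous_sin).aestronglyMeasurable ?_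
    (intervalIntegrable_const) ?_).2.differentiableAt
  · filter_upwards [hnhds] with x hx
    exact (continuous_comp_mul_sin hgc (hsub' hx)).aestronglyMeasurable
  · refine Eventually.of_forall fun θ _ x hx => ?_
    have h1 := hC _ (Ioo_subset_Icc_self (mul_sin_mem_Ioo hx θ))
    rw [norm_mul]
    exact (mul_le_of_le_one_right (norm_nonneg _) (Real.abs_sin_le_one θ)).trans h1
  · refine Eventually.of_forall fun θ _ x hx => ?_
    exact (hg _ (mul_sin_mem_Ioo (hsub' hx) θ)).comp x
      ((hasDerivAt_id x).mul_const (Real.sin θ) |>.congr_deriv (one_mul _))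

lemma f_eq_mul (p : ℝ) {x : ℝ} (hx : 0 < x) :
    f p x = x ^ 2 * (1 / 2 - x ^ (p - 2) / p) := by
  rw [f, rpow_eq_sq_mul p hx]; ring

lemma f_pos {p : ℝ} (hp : 2 < p) {x : ℝ} (hx : x ∈ Ioo 0 ((p / 2) ^ (1 / (p - 2)))) :
    0 < f p x := by
  have h : x ^ (p - 2) < p / 2 := by
    have := Real.rpow_lt_rpow hx.1.le hx.2 (show 0 < p - 2 by linarith)
    rwa [← Real.rpow_mul (by linarith), one_div_mul_cancel (by linarith), Real.rpow_one] at this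
  rw [f_eq_mul p hx.1]
  have : x ^ (p - 2) / p < 1 / 2 := by rw [div_lt_iff₀ (by linarith)]; linarith
  exact mul_pos (pow_pos hx.1 2) (by linarith)

lemma f_right_endpoint {p : ℝ} (hp : 2 < p) : f p ((p / 2) ^ (1 / (p - 2))) = 0 := by
  rw [f_eq_mul p (Real.rpow_pos_of_pos (by linarith) _), ← Real.rpow_mul (by linarith),
    one_div_mul_cancel (by linarith), Real.rpow_one]
  field_simp
  ring

lemma one_lt_right_endpoint {p : ℝ} (hp : 2 < p) : 1 < (p / 2) ^ (1 / (p - 2)) :=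
  Real.one_lt_rpow (by linarith) (one_div_pos.2 (by linarith))

lemma f_zero {p : ℝ} (hp : 2 < p) : f p 0 = 0 := by
  simp [f, Real.zero_rpow (show p ≠ 0 by linarith)]

lemma continuous_f {p : ℝ} (hp : 2 < p) : Continuous (f p) :=
  ((continuous_pow 2).div_const 2).sub
    ((Real.continuous_rpow_const (by linarith)).div_const p)

/-- The square root of the depth of the potential well. -/
noncomputable def wellRadius (p : ℝ) : ℝ := √(f p 1)

lemma f_one_pos {p : ℝ} (hp : 2 < p) : 0 < f p 1 :=
  f_pos hp ⟨one_pos, one_lt_right_endpoint hp⟩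

lemma wellRadius_pos {p : ℝ} (hp : 2 < p) : 0 < wellRadius p := Real.sqrt_pos.2 (f_one_pos hp)

lemma zero_mem_well {p : ℝ} (hp : 2 < p) : (0 : ℝ) ∈ Ioo (-wellRadius p) (wellRadius p) :=
  ⟨by linarith [wellRadius_pos hp], wellRadius_pos hp⟩

lemma potRoot_mem_well {p : ℝ} (hp : 2 < p) {x : ℝ}
    (hx : x ∈ Ioo 0 ((p / 2) ^ (1 / (p - 2)))) :
    potRoot p x ∈ Ioo (-wellRadius p) (wellRadius p) := by
  rw [mem_Ioo, ← abs_lt]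
  refine Real.lt_sqrt_of_sq_lt ?_
  rw [sq_abs, potRoot_sq hp hx.1, pot]
  linarith [f_pos hp hx]

lemma potRoot_nonpos_of_le {p x : ℝ} (h : x ≤ 1) : potRoot p x ≤ 0 :=
  mul_nonpos_of_nonpos_of_nonneg (by linarith) (Real.sqrt_nonneg _)

lemma potRoot_nonneg_of_ge {p x : ℝ} (h : 1 ≤ x) : 0 ≤ potRoot p x :=
  mul_nonneg (by linarith) (Real.sqrt_nonneg _)

lemma exists_potRoot_eq {p : ℝ} (hp : 2 < p) {s : ℝ}
    (hs : s ∈ Ioo (-wellRadius p) (wellRadius p)) : ∃ x ∈ Ioi (0 : ℝ), potRoot p x = s := by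
  have hsq : s ^ 2 < f p 1 := by
    have := sq_lt_sq' hs.1 hs.2
    rwa [wellRadius, Real.sq_sqrt (f_one_pos hp).le] at this
  have hc := one_lt_right_endpoint hp
  have h0 : ∀ᶠ x in 𝓝[>] (0 : ℝ), f p x < f p 1 - s ^ 2 := by
    refine ((continuous_f hp).tendsto 0).mono_left nhdsWithin_le_nhds |>.eventually_lt_const ?_
    rw [f_zero hp]; linarith
  obtain ⟨x, hfx, hx0, hx1⟩ := (h0.and (Ioo_mem_nhdsGT one_pos)).exists
  have hlow : potRoot p x ≤ s := by
    have h1 : s ^ 2 < potRoot p x ^ 2 := by rw [potRoot_sq hp hx0, pot]; linarith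
    have h2 := potRoot_nonpos_of_le (p := p) hx1.le
    nlinarith
  have hhigh : s ≤ potRoot p ((p / 2) ^ (1 / (p - 2))) := by
    have h1 : s ^ 2 < potRoot p ((p / 2) ^ (1 / (p - 2))) ^ 2 := by
      rw [potRoot_sq hp (one_pos.trans hc), pot, f_right_endpoint hp]; linarith
    have h2 := potRoot_nonneg_of_ge (p := p) hc.le
    nlinarith
  have hcont : ContinuousOn (potRoot p) (Icc x ((p / 2) ^ (1 / (p - 2)))) := fun y hy =>
    (analyticAt_potRoot hp (hx0.trans_le hy.1)).continuousAt.continuousWithinAt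
  obtain ⟨y, hy, rfl⟩ := intermediate_value_Icc (hx1.trans hc).le hcont ⟨hlow, hhigh⟩
  exact ⟨y, hx0.trans_le hy.1, rfl⟩

/-- The inverse of the signed square root of the potential. -/
noncomputable def potRootInv (p : ℝ) : ℝ → ℝ := Function.invFunOn (potRoot p) (Ioi 0)

lemma potRootInv_pos {p : ℝ} (hp : 2 < p) {s : ℝ}
    (hs : s ∈ Ioo (-wellRadius p) (wellRadius p)) : 0 < potRootInv p s :=
  Function.invFunOn_mem (exists_potRoot_eq hp hs)

lemma potRoot_potRootInv {p : ℝ} (hp : 2 < p) {s : ℝ}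
    (hs : s ∈ Ioo (-wellRadius p) (wellRadius p)) : potRoot p (potRootInv p s) = s :=
  Function.invFunOn_eq (exists_potRoot_eq hp hs)

lemma potRootInv_potRoot {p : ℝ} (hp : 2 < p) {x : ℝ} (hx : 0 < x) :
    potRootInv p (potRoot p x) = x :=
  (strictMonoOn_potRoot hp).injOn.leftInvOn_invFunOn hx

lemma strictMonoOn_potRootInv {p : ℝ} (hp : 2 < p) :
    StrictMonoOn (potRootInv p) (Ioo (-wellRadius p) (wellRadius p)) := fun s hs t ht hst => by
  rw [← (strictMonoOn_potRoot hp).lt_iff_lt (potRootInv_pos hp hs) (potRootInv_pos hp ht),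
    potRoot_potRootInv hp hs, potRoot_potRootInv hp ht]
  exact hst

/-- The derivative of the inverse of the signed square root of the potential. -/
noncomputable def invDeriv (p s : ℝ) : ℝ := invSlope p (potRootInv p s)

lemma invDeriv_pos {p : ℝ} (hp : 2 < p) {s : ℝ}
    (hs : s ∈ Ioo (-wellRadius p) (wellRadius p)) : 0 < invDeriv p s :=
  invSlope_pos hp (potRootInv_pos hp hs)

lemma hasDerivAt_potRootInv {p : ℝ} (hp : 2 < p) {s : ℝ}
    (hs : s ∈ Ioo (-wellRadius p) (wellRadius p)) :
    HasDerivAt (potRootInv p) (invDeriv p s) s := by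
  have hx := potRootInv_pos hp hs
  have h := (analyticAt_potRoot hp hx).hasStrictDerivAt.to_local_left_inverse
    (deriv_potRoot_pos hp hx).ne' (g := potRootInv p) (by
      filter_upwards [lt_mem_nhds hx] with y hy using potRootInv_potRoot hp hy)
  rw [potRoot_potRootInv hp hs] at h
  exact h.hasDerivAt

lemma hasDerivAt_invDeriv {p : ℝ} (hp : 2 < p) {s : ℝ}
    (hs : s ∈ Ioo (-wellRadius p) (wellRadius p)) :
    HasDerivAt (invDeriv p)
      (deriv (invSlope p) (potRootInv p s) * invSlope p (potRootInv p s)) s :=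
  (analyticAt_invSlope hp (potRootInv_pos hp hs)).differentiableAt.hasDerivAt.comp s
    (hasDerivAt_potRootInv hp hs)

lemma continuousOn_invDeriv {p : ℝ} (hp : 2 < p) :
    ContinuousOn (invDeriv p) (Ioo (-wellRadius p) (wellRadius p)) := fun _ hs =>
  (hasDerivAt_invDeriv hp hs).continuousAt.continuousWithinAt

lemma strictConvexOn_invDeriv {p : ℝ} (hp : 2 < p) :
    StrictConvexOn ℝ (Ioo (-wellRadius p) (wellRadius p)) (invDeriv p) := by
  refine StrictMonoOn.strictConvexOn_of_deriv (convex_Ioo _ _) (continuousOn_invDeriv hp) ?_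
  rw [interior_Ioo]
  refine ((strictMonoOn_invSlope_mul_deriv hp).comp (strictMonoOn_potRootInv hp)
    fun s hs => potRootInv_pos hp hs).congr fun s hs => ?_
  exact (hasDerivAt_invDeriv hp hs).deriv.symm

lemma differentiableAt_arcMean_invDeriv {p : ℝ} (hp : 2 < p) {k : ℝ}
    (hk : k ∈ Ioo (-wellRadius p) (wellRadius p)) :
    DifferentiableAt ℝ (arcMean (invDeriv p)) k := by
  refine differentiableAt_arcMean (fun s hs => hasDerivAt_invDeriv hp hs) (fun s hs => ?_) hk
  have hx := potRootInv_pos hp hs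
  have h := (analyticAt_invSlope hp hx).deriv.continuousAt.mul
    (analyticAt_invSlope hp hx).continuousAt
  exact (h.comp (f := potRootInv p)
    (hasDerivAt_potRootInv hp hs).continuousAt).continuousWithinAt

lemma arcMean_invDeriv_zero {p : ℝ} (hp : 2 < p) :
    arcMean (invDeriv p) 0 = √2 * (Real.pi / √(p - 2)) := by
  have h : potRootInv p 0 = 1 := by
    rw [← potRoot_one p]; exact potRootInv_potRoot hp one_pos
  rw [arcMean_zero, invDeriv, h, invSlope, deriv_potRoot_one hp,
    Real.sqrt_div (by linarith : (0 : ℝ) ≤ p - 2), inv_div]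
  ring

lemma f_lt_f_of_lt {p : ℝ} (hp : 2 < p) {x y : ℝ} (hx : 0 < x) (hxy : x < y) (hy : y ≤ 1) :
    f p x < f p y := by
  have h1 := strictMonoOn_potRoot hp hx (hx.trans hxy) hxy
  have h2 := potRoot_nonpos_of_le (p := p) hy
  have h3 := potRoot_sq hp hx
  have h4 := potRoot_sq hp (hx.trans hxy)
  rw [pot] at h3 h4
  nlinarith

/-- The substitution `t = x(k sin θ)`, with `x` the inverse of the signed square root of the
potential, turns the length integral into a mean over an arc. -/
lemma integral_eq_arcMean {p : ℝ} (hp : 2 < p) {z a b : ℝ}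
    (hz : z ∈ Ioo 0 ((p / 2) ^ (1 / (p - 2)))) (hz1 : z ≠ 1) (ha : a ∈ Ioo (0 : ℝ) 1)
    (hb : b ∈ Ioo 1 ((p / 2) ^ (1 / (p - 2)))) (hfa : f p a = f p z) (hfb : f p b = f p z) :
    IntervalIntegrable (fun t => 1 / √(f p t - f p z)) volume a b ∧
      ∫ t in a..b, 1 / √(f p t - f p z) = arcMean (invDeriv p) (potRoot p z) := by
  have hb0 : 0 < b := one_pos.trans hb.1
  obtain ⟨k, hk⟩ : ∃ k, k = |potRoot p z| := ⟨_, rfl⟩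
  have hk0 : 0 < k := hk ▸ abs_pos.2 (potRoot_ne_zero hp hz.1 hz1)
  have hkS : k ∈ Ioo (-wellRadius p) (wellRadius p) := by
    have := abs_lt.2 (potRoot_mem_well hp hz)
    rw [← hk] at this
    exact ⟨by linarith, this⟩
  have hksq : k ^ 2 = f p 1 - f p z := by rw [hk, sq_abs, potRoot_sq hp hz.1, pot]
  have hka : potRoot p a = -k := by
    have h1 := potRoot_sq hp ha.1
    rw [pot, hfa, ← hksq, sq_eq_sq_iff_eq_or_eq_neg] at h1
    have h2 := potRoot_nonpos_of_le (p := p) ha.2.le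
    rcases h1 with h1 | h1 <;> linarith
  have hkb : potRoot p b = k := by
    have h1 := potRoot_sq hp hb0
    rw [pot, hfb, ← hksq, sq_eq_sq_iff_eq_or_eq_neg] at h1
    have h2 := potRoot_nonneg_of_ge (p := p) hb.1.le
    rcases h1 with h1 | h1 <;> linarith
  have hmem := mul_sin_mem_Ioo hkS
  have hcos : ∀ θ ∈ Ioo (-(Real.pi / 2)) (Real.pi / 2), 0 < k * Real.cos θ := fun θ hθ =>
    mul_pos hk0 (Real.cos_pos_of_mem_Ioo hθ)
  have hderiv : ∀ θ ∈ Ioo (-(Real.pi / 2)) (Real.pi / 2),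
      HasDerivWithinAt (fun θ => potRootInv p (k * Real.sin θ))
        (invDeriv p (k * Real.sin θ) * (k * Real.cos θ)) (Ioo (-(Real.pi / 2)) (Real.pi / 2)) θ :=
    fun θ _ => ((hasDerivAt_potRootInv hp (hmem θ)).comp θ
      ((Real.hasDerivAt_sin θ).const_mul k)).hasDerivWithinAt
  have hinj : InjOn (fun θ => potRootInv p (k * Real.sin θ))
      (Ioo (-(Real.pi / 2)) (Real.pi / 2)) := by
    intro θ hθ φ hφ h
    have h1 := (strictMonoOn_potRootInv hp).injOn (hmem θ) (hmem φ) h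
    exact Real.injOn_sin (Ioo_subset_Icc_self hθ) (Ioo_subset_Icc_self hφ)
      (mul_left_cancel₀ hk0.ne' h1)
  have himage : (fun θ => potRootInv p (k * Real.sin θ)) '' Ioo (-(Real.pi / 2)) (Real.pi / 2) =
      Ioo a b := by
    ext t
    constructor
    · rintro ⟨θ, hθ, rfl⟩
      have h1 : -1 < Real.sin θ := by
        rw [← Real.sin_pi_div_two, ← Real.sin_neg]
        exact Real.sin_lt_sin_of_lt_of_le_pi_div_two (by linarith) hθ.2.le (by linarith [hθ.1])
      have h2 : Real.sin θ < 1 := by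
        rw [← Real.sin_pi_div_two]
        exact Real.sin_lt_sin_of_lt_of_le_pi_div_two hθ.1.le le_rfl hθ.2
      constructor
      · rw [← (strictMonoOn_potRoot hp).lt_iff_lt ha.1 (potRootInv_pos hp (hmem θ)),
          potRoot_potRootInv hp (hmem θ), hka]
        nlinarith
      · rw [← (strictMonoOn_potRoot hp).lt_iff_lt (potRootInv_pos hp (hmem θ)) hb0,
          potRoot_potRootInv hp (hmem θ), hkb]
        nlinarith
    · intro ht
      have ht0 : 0 < t := ha.1.trans ht.1
      have h1 := strictMonoOn_potRoot hp ha.1 ht0 ht.1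
      have h2 := strictMonoOn_potRoot hp ht0 hb0 ht.2
      rw [hka] at h1
      rw [hkb] at h2
      have h3 : -1 < potRoot p t / k := by rw [lt_div_iff₀ hk0]; linarith
      have h4 : potRoot p t / k < 1 := by rw [div_lt_iff₀ hk0]; linarith
      refine ⟨Real.arcsin (potRoot p t / k),
        ⟨Real.neg_pi_div_two_lt_arcsin.2 h3, Real.arcsin_lt_pi_div_two.2 h4⟩, ?_⟩
      simp only [Real.sin_arcsin h3.le h4.le]
      rw [mul_div_cancel₀ _ hk0.ne', potRootInv_potRoot hp ht0]
  have hintegrand : EqOn (fun θ => |invDeriv p (k * Real.sin θ) * (k * Real.cos θ)| •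
      (1 / √(f p (potRootInv p (k * Real.sin θ)) - f p z)))
      (fun θ => invDeriv p (k * Real.sin θ)) (Ioo (-(Real.pi / 2)) (Real.pi / 2)) := by
    intro θ hθ
    have h1 := potRoot_sq hp (potRootInv_pos hp (hmem θ))
    rw [potRoot_potRootInv hp (hmem θ), pot] at h1
    have h2 : f p (potRootInv p (k * Real.sin θ)) - f p z = (k * Real.cos θ) ^ 2 := by
      rw [mul_pow, Real.cos_sq']
      linarith
    have h3 := hcos θ hθ
    simp only [h2, smul_eq_mul]
    rw [Real.sqrt_sq h3.le, abs_of_pos (mul_pos (invDeriv_pos hp (hmem θ)) h3), mul_assoc,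
      mul_one_div_cancel h3.ne', mul_one]
  have hab : a ≤ b := (ha.2.trans hb.1).le
  have hpi : -(Real.pi / 2) ≤ Real.pi / 2 := by linarith [Real.pi_pos]
  constructor
  · rw [intervalIntegrable_iff_integrableOn_Ioo_of_le hab, ← himage,
      integrableOn_image_iff_integrableOn_abs_deriv_smul measurableSet_Ioo hderiv hinj,
      integrableOn_congr_fun hintegrand measurableSet_Ioo,
      ← intervalIntegrable_iff_integrableOn_Ioo_of_le hpi]
    exact (continuous_comp_mul_sin (continuousOn_invDeriv hp) hkS).intervalIntegrable _ _
  · rw [← arcMean_abs, ← hk, arcMean, intervalIntegral.integral_of_le hab,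
      intervalIntegral.integral_of_le hpi, integral_Ioc_eq_integral_Ioo,
      integral_Ioc_eq_integral_Ioo, ← himage,
      integral_image_eq_integral_abs_deriv_smul measurableSet_Ioo hderiv hinj]
    exact setIntegral_congr_fun measurableSet_Ioo hintegrand

lemma neg_log_le_integral {p : ℝ} (hp : 2 < p) {z a b : ℝ} (ha : a ∈ Ioo (0 : ℝ) 1)
    (hb : 1 < b) (hfa : f p a = f p z)
    (hint : IntervalIntegrable (fun t => 1 / √(f p t - f p z)) volume a b) :
    -Real.log a ≤ 1 / √2 * ∫ t in a..b, 1 / √(f p t - f p z) := by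
  have hab : a ≤ b := (ha.2.trans hb).le
  have h1 : ∫ t in a..1, 1 / √(f p t - f p z) ≤ ∫ t in a..b, 1 / √(f p t - f p z) :=
    intervalIntegral.integral_mono_interval le_rfl ha.2.le hb.le
      (Eventually.of_forall fun t => by positivity) hint
  have hint1 : IntervalIntegrable (fun t => 1 / √(f p t - f p z)) volume a 1 :=
    hint.mono_set (by
      rw [uIcc_of_le ha.2.le, uIcc_of_le hab]
      exact Icc_subset_Icc_right hb.le)
  have hinv : IntervalIntegrable (fun t : ℝ => t⁻¹) volume a 1 :=
    intervalIntegrable_inv_iff.2 (Or.inr (by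
      rw [uIcc_of_le ha.2.le]
      exact fun h => ha.1.not_ge h.1))
  have h2 : ∫ t in a..1, √2 * t⁻¹ ≤ ∫ t in a..1, 1 / √(f p t - f p z) := by
    refine intervalIntegral.integral_mono_on_of_le_Ioo ha.2.le (hinv.const_mul _) hint1
      fun t ht => ?_
    have ht0 : 0 < t := ha.1.trans ht.1
    have h3 : 0 < f p t - f p z := by
      rw [← hfa]
      linarith [f_lt_f_of_lt hp ha.1 ht.1 ht.2.le]
    have h4 : f p t - f p z ≤ t ^ 2 / 2 := by
      have h5 := f_pos hp ⟨ha.1, ha.2.trans (one_lt_right_endpoint hp)⟩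
      have h6 : 0 ≤ t ^ p / p := div_nonneg (Real.rpow_nonneg ht0.le _) (by linarith)
      rw [← hfa]
      simp only [f] at h5 ⊢
      linarith
    have h7 : √(f p t - f p z) ≤ t / √2 := by
      refine (Real.sqrt_le_sqrt h4).trans_eq ?_
      rw [Real.sqrt_div' _ (by norm_num), Real.sqrt_sq ht0.le]
    calc √2 * t⁻¹ = 1 / (t / √2) := by rw [one_div_div, div_eq_mul_inv]
      _ ≤ 1 / √(f p t - f p z) := one_div_le_one_div_of_le (Real.sqrt_pos.2 h3) h7
  have h8 : ∫ t in a..1, √2 * t⁻¹ = √2 * -Real.log a := by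
    rw [intervalIntegral.integral_const_mul, integral_inv_of_pos ha.1 one_pos, one_div,
      Real.log_inv]
  rw [one_div_mul_eq_div, le_div_iff₀ (by positivity)]
  linarith

/-- for `p > 2`, the length function
`L₁(z) = (1/√2) ∫_{a(z)}^{b(z)} dt/√(f(t)-f(z))` (with `a(z) ∈ (0,1)`,
`b(z) ∈ (1,(p/2)^(1/(p-2)))` the unique points where `f(a(z)) = f(b(z)) = f(z)`) is
positive and differentiable on `(0,(p/2)^(1/(p-2))) \ {1}`, strictly decreasing on `(0,1)`,
strictly increasing on `(1,(p/2)^(1/(p-2)))`, tends to `+∞` as `z → 0⁺` and as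
`z → ((p/2)^(1/(p-2)))⁻`, and tends to `π/√(p-2)` as `z → 1` from either side. -/
theorem stmt_15 (p : ℝ) (hp : 2 < p) (a b : ℝ → ℝ)
    (hab : ∀ z ∈ Set.Ioo (0 : ℝ) ((p / 2) ^ (1 / (p - 2))) \ {1},
      a z ∈ Set.Ioo (0 : ℝ) 1 ∧ b z ∈ Set.Ioo (1 : ℝ) ((p / 2) ^ (1 / (p - 2))) ∧
      f p (a z) = f p z ∧ f p (b z) = f p z)
    (L₁ : ℝ → ℝ)
    (hL₁ : ∀ z ∈ Set.Ioo (0 : ℝ) ((p / 2) ^ (1 / (p - 2))) \ {1},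
      L₁ z = (1 / Real.sqrt 2) * ∫ t in (a z)..(b z), 1 / Real.sqrt (f p t - f p z)) :
    (∀ z ∈ Set.Ioo (0 : ℝ) ((p / 2) ^ (1 / (p - 2))) \ {1}, 0 < L₁ z) ∧
    (∀ z ∈ Set.Ioo (0 : ℝ) ((p / 2) ^ (1 / (p - 2))) \ {1}, DifferentiableAt ℝ L₁ z) ∧
    StrictAntiOn L₁ (Set.Ioo (0 : ℝ) 1) ∧
    StrictMonoOn L₁ (Set.Ioo (1 : ℝ) ((p / 2) ^ (1 / (p - 2)))) ∧
    Filter.Tendsto L₁ (nhdsWithin 0 (Set.Ioi 0)) Filter.atTop ∧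
    Filter.Tendsto L₁
      (nhdsWithin ((p / 2) ^ (1 / (p - 2))) (Set.Iio ((p / 2) ^ (1 / (p - 2)))))
      Filter.atTop ∧
    Filter.Tendsto L₁ (nhdsWithin 1 {(1 : ℝ)}ᶜ)
      (nhds (Real.pi / Real.sqrt (p - 2))) := by
  have hdom : ∀ z, z ∈ Ioo (0 : ℝ) ((p / 2) ^ (1 / (p - 2))) \ {1} →
      L₁ z = 1 / √2 * arcMean (invDeriv p) (potRoot p z) ∧
        IntervalIntegrable (fun t => 1 / √(f p t - f p z)) volume (a z) (b z) := by
    intro z hz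
    obtain ⟨ha, hb, hfa, hfb⟩ := hab z hz
    obtain ⟨h1, h2⟩ := integral_eq_arcMean hp hz.1 hz.2 ha hb hfa hfb
    exact ⟨by rw [hL₁ z hz, h2], h1⟩
  have hc := one_lt_right_endpoint hp
  have hsqrt : 0 < 1 / √2 := by positivity
  have hleft : ∀ z ∈ Ioo (0 : ℝ) 1, z ∈ Ioo (0 : ℝ) ((p / 2) ^ (1 / (p - 2))) \ {1} :=
    fun z hz => ⟨⟨hz.1, hz.2.trans hc⟩, hz.2.ne⟩
  have hright : ∀ z ∈ Ioo (1 : ℝ) ((p / 2) ^ (1 / (p - 2))),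
      z ∈ Ioo (0 : ℝ) ((p / 2) ^ (1 / (p - 2))) \ {1} :=
    fun z hz => ⟨⟨one_pos.trans hz.1, hz.2⟩, hz.1.ne'⟩
  have hmono := strictMonoOn_arcMean (continuousOn_invDeriv hp) (strictConvexOn_invDeriv hp)
  have hblow : ∀ l : Filter ℝ, Tendsto (f p) l (𝓝 0) →
      (∀ᶠ z in l, z ∈ Ioo (0 : ℝ) ((p / 2) ^ (1 / (p - 2))) \ {1}) → Tendsto L₁ l atTop := by
    intro l hl hev
    refine tendsto_atTop.2 fun C => ?_
    have hε0 : 0 < min (Real.exp (-C)) (1 / 2) := lt_min (Real.exp_pos _) (by norm_num)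
    have hε1 : min (Real.exp (-C)) (1 / 2) < 1 := (min_le_right _ _).trans_lt (by norm_num)
    have hfε := f_pos hp ⟨hε0, hε1.trans hc⟩
    filter_upwards [hev, hl.eventually_lt_const hfε] with z hz hfz
    obtain ⟨ha, hb, hfa, hfb⟩ := hab z hz
    have haε : a z < min (Real.exp (-C)) (1 / 2) := by
      by_contra! h
      rcases h.eq_or_lt with h | h
      · rw [← hfa, ← h] at hfz; exact hfz.false
      · have := f_lt_f_of_lt hp hε0 h ha.2.le
        linarith
    have h1 := neg_log_le_integral hp ha hb.1 hfa (hdom z hz).2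
    rw [← hL₁ z hz] at h1
    have h2 := Real.log_le_log ha.1 (haε.le.trans (min_le_left _ _))
    rw [Real.log_exp] at h2
    linarith
  refine ⟨fun z hz => ?_, fun z hz => ?_, fun x hx y hy hxy => ?_, fun x hx y hy hxy => ?_,
    ?_, ?_, ?_⟩
  · rw [(hdom z hz).1]
    exact mul_pos hsqrt (arcMean_pos (continuousOn_invDeriv hp) (fun s hs => invDeriv_pos hp hs)
      (potRoot_mem_well hp hz.1))
  · have hopen : IsOpen (Ioo (0 : ℝ) ((p / 2) ^ (1 / (p - 2))) \ {1}) :=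
      isOpen_Ioo.sdiff isClosed_singleton
    have h : L₁ =ᶠ[𝓝 z] fun y => 1 / √2 * arcMean (invDeriv p) (potRoot p y) := by
      filter_upwards [hopen.mem_nhds hz] with y hy using (hdom y hy).1
    refine DifferentiableAt.congr_of_eventuallyEq (DifferentiableAt.const_mul ?_ _) h
    exact (differentiableAt_arcMean_invDeriv hp (potRoot_mem_well hp hz.1)).comp z
      (analyticAt_potRoot hp hz.1.1).differentiableAt
  · have hx' := hleft x hx
    have hy' := hleft y hy
    rw [(hdom x hx').1, (hdom y hy').1, ← arcMean_neg _ (potRoot p x),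
      ← arcMean_neg _ (potRoot p y)]
    have h1 := potRoot_mem_well hp hx'.1
    have h2 := potRoot_mem_well hp hy'.1
    refine mul_lt_mul_of_pos_left (hmono ⟨?_, ?_⟩ ⟨?_, ?_⟩ ?_) hsqrt
    · linarith [potRoot_nonpos_of_le (p := p) hy.2.le]
    · linarith [h2.1]
    · linarith [potRoot_nonpos_of_le (p := p) hx.2.le]
    · linarith [h1.1]
    · exact neg_lt_neg (strictMonoOn_potRoot hp hx.1 hy.1 hxy)
  · have hx' := hright x hx
    have hy' := hright y hy
    rw [(hdom x hx').1, (hdom y hy').1]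
    exact mul_lt_mul_of_pos_left (hmono
      ⟨potRoot_nonneg_of_ge hx.1.le, (potRoot_mem_well hp hx'.1).2⟩
      ⟨potRoot_nonneg_of_ge hy.1.le, (potRoot_mem_well hp hy'.1).2⟩
      (strictMonoOn_potRoot hp hx'.1.1 hy'.1.1 hxy)) hsqrt
  · refine hblow _ ?_ ?_
    · have h := (continuous_f hp).tendsto 0
      rw [f_zero hp] at h
      exact h.mono_left nhdsWithin_le_nhds
    · filter_upwards [Ioo_mem_nhdsGT one_pos] with z hz using hleft z hz
  · refine hblow _ ?_ ?_
    · have h := (continuous_f hp).tendsto ((p / 2) ^ (1 / (p - 2)))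
      rw [f_right_endpoint hp] at h
      exact h.mono_left nhdsWithin_le_nhds
    · filter_upwards [Ioo_mem_nhdsLT hc] with z hz using hright z hz
  · have h1 : ContinuousAt (fun z => 1 / √2 * arcMean (invDeriv p) (potRoot p z)) 1 := by
      refine continuousAt_const.mul (ContinuousAt.comp (g := arcMean (invDeriv p)) ?_
        (analyticAt_potRoot hp one_pos).continuousAt)
      rw [potRoot_one]
      exact (differentiableAt_arcMean_invDeriv hp (zero_mem_well hp)).continuousAt
    have h2 := h1.tendsto
    rw [potRoot_one, arcMean_invDeriv_zero hp, ← mul_assoc,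
      one_div_mul_cancel (by positivity : √(2 : ℝ) ≠ 0), one_mul] at h2
    refine (h2.mono_left nhdsWithin_le_nhds).congr' ?_
    filter_upwards [self_mem_nhdsWithin,
      mem_nhdsWithin_of_mem_nhds (Ioo_mem_nhds one_pos hc)] with z hz1 hz using
      (hdom z ⟨hz, hz1⟩).1.symm
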